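/- arXiv:1810.05814 — 3 statements merged into one kernel-verified Lean document; each statement's English description precedes it below -/
import Mathlib

section
/- Pointwise aggregation for Dirichlet densities: let n ≥ 2 and α : Fin n → ℕ with α i ≥ 1 for all i. For every (x₂, x₃, …, x_n) ∈ Δ°_{n−1}, d_{n−1}(α₁ + α₂, α₃, …, α_n)(x₂, x₃, …, x_n) = ∫_{y ∈ (0, x₂)} d_n(α₁, α₂, α₃, …, α_n)(y, x₂ − y, x₃, …, x_n) dy. -/
open MeasureTheory Finset

noncomputable section

/-- The open simplex `Δ°_n = {x : Fin n → ℝ | (∀ i, 0 < x i) ∧ ∑ i, x i = 1}`. -/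
def openSimplex (n : ℕ) : Set (Fin n → ℝ) := {x | (∀ i, 0 < x i) ∧ ∑ i, x i = 1}

/-- The open parameter domain for `Δ°_{m+1}`: the first `m` coordinates are
positive with sum `< 1`. -/
def simplexDomain (m : ℕ) : Set (Fin m → ℝ) := {y | (∀ i, 0 < y i) ∧ ∑ i, y i < 1}

/-- Parametrize the simplex `Δ°_{m+1}`: the last coordinate is `1 - ∑` of the others. -/
def toSimplex (m : ℕ) (y : Fin m → ℝ) : Fin (m + 1) → ℝ :=
  Fin.snoc y (1 - ∑ i, y i)

/-- The `m`-dimensional Lebesgue measure on the open simplex `Δ°_{m+1}`, obtained by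
pushing forward Lebesgue measure on the open parameter domain along the
parametrization in which the last coordinate is `1 - ∑` of the first `m`. -/
def simplexMeasure (m : ℕ) : Measure (Fin (m + 1) → ℝ) :=
  Measure.map (toSimplex m) (volume.restrict (simplexDomain m))

/-- The Dirichlet density `d(α)(x) = (Γ(∑ i, α i) / ∏ i, Γ(α i)) · ∏ i, (x i)^(α i − 1)`
with natural-number hyperparameters `α`. -/
def dirDensity {X : Type*} [Fintype X] (α : X → ℕ) (x : X → ℝ) : ℝ :=
  (Real.Gamma (∑ i, (α i : ℝ)) / ∏ i, Real.Gamma (α i : ℝ)) * ∏ i, x i ^ (α i - 1)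

/-- The Dirichlet distribution `Dir(α)` on `Δ°_{m+1}`, i.e. the measure with
density `d(α)` with respect to Lebesgue measure on the simplex. -/
def Dir (m : ℕ) (α : Fin (m + 1) → ℕ) : Measure (Fin (m + 1) → ℝ) :=
  (simplexMeasure m).withDensity fun x => ENNReal.ofReal (dirDensity α x)

/-- Pushforward of a multiset along `h`: `M(h)(α)(j) = ∑_{i : h i = j} α i`. -/
def mPush {n m : ℕ} (h : Fin n → Fin m) (α : Fin n → ℕ) : Fin m → ℕ :=
  fun j => ∑ i ∈ Finset.univ.filter (fun i => h i = j), α i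

/-- Pushforward of a point of the simplex along `h`: `D(h)(y)(j) = ∑_{i : h i = j} y i`. -/
def dPush {n m : ℕ} (h : Fin n → Fin m) (y : Fin n → ℝ) : Fin m → ℝ :=
  fun j => ∑ i ∈ Finset.univ.filter (fun i => h i = j), y i

/-- The beta integral over `(0, a)` with natural-number exponents. -/
theorem integral_pow_mul_sub_pow (p q : ℕ) {a : ℝ} (ha : 0 < a) :
    ∫ y in (0 : ℝ)..a, y ^ p * (a - y) ^ q
      = a ^ (p + q + 1) * (Real.Gamma (p + 1) * Real.Gamma (q + 1) / Real.Gamma (p + q + 2)) := by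
  have h := Complex.betaIntegral_scaled ((p : ℂ) + 1) ((q : ℂ) + 1) ha
  have hp : 0 < ((p : ℂ) + 1).re := by simp; positivity
  have hq : 0 < ((q : ℂ) + 1).re := by simp; positivity
  rw [Complex.betaIntegral_eq_Gamma_mul_div _ _ hp hq] at h
  have e1 : (p : ℂ) + 1 + (q + 1) - 1 = ((p + q + 1 : ℕ) : ℂ) := by push_cast; ring
  have e2 : (p : ℂ) + 1 + (q + 1) = ((p + q + 2 : ℝ) : ℂ) := by push_cast; ring
  have e3 : (p : ℂ) + 1 = ((p + 1 : ℝ) : ℂ) := by push_cast; ring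
  have e4 : (q : ℂ) + 1 = ((q + 1 : ℝ) : ℂ) := by push_cast; ring
  rw [e1, e2, e3, e4, Complex.Gamma_ofReal, Complex.Gamma_ofReal, Complex.Gamma_ofReal,
    ← e3, ← e4] at h
  simp only [add_sub_cancel_right, Complex.cpow_natCast] at h
  rw [← Complex.ofReal_inj, ← intervalIntegral.integral_ofReal]
  push_cast
  exact h

/-- **Pointwise aggregation for Dirichlet densities.** Let `n = m + 2 ≥ 2` and
`α : Fin n → ℕ` with `α i ≥ 1` for all `i`. For every point
`x = (x₂, x₃, …, x_n) ∈ Δ°_{n−1}`,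
`d_{n−1}(α₁ + α₂, α₃, …, α_n)(x₂, x₃, …, x_n)
  = ∫_{y ∈ (0, x₂)} d_n(α₁, α₂, α₃, …, α_n)(y, x₂ − y, x₃, …, x_n) dy`. -/
theorem dirichlet_aggregation_pointwise (m : ℕ) (α : Fin (m + 2) → ℕ)
    (hα : ∀ i, 1 ≤ α i) (x : Fin (m + 1) → ℝ) (hx : x ∈ openSimplex (m + 1)) :
    dirDensity (Fin.cons (α 0 + α 1) (fun i : Fin m => α i.succ.succ)) x
      = ∫ y in Set.Ioo (0 : ℝ) (x 0),
          dirDensity α (Fin.cons y (Fin.cons (x 0 - y) (fun i : Fin m => x i.succ))) := by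
  have hx0 : 0 < x 0 := hx.1 0
  obtain ⟨p, hp⟩ := Nat.exists_eq_add_of_le' (hα 0)
  obtain ⟨q, hq⟩ := Nat.exists_eq_add_of_le' (hα 1)
  have hbeta := integral_pow_mul_sub_pow p q hx0
  rw [intervalIntegral.integral_of_le hx0.le, integral_Ioc_eq_integral_Ioo] at hbeta
  have hΓp : Real.Gamma (p + 1) ≠ 0 := (Real.Gamma_pos_of_pos (by positivity)).ne'
  have hΓq : Real.Gamma (q + 1) ≠ 0 := (Real.Gamma_pos_of_pos (by positivity)).ne'
  have hΓpq : Real.Gamma (p + q + 2) ≠ 0 := (Real.Gamma_pos_of_pos (by positivity)).ne'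
  have hΓ : ∏ i : Fin m, Real.Gamma (α i.succ.succ : ℝ) ≠ 0 :=
    Finset.prod_ne_zero_iff.mpr fun i _ =>
      (Real.Gamma_pos_of_pos (Nat.cast_pos.mpr (hα i.succ.succ))).ne'
  have hexp : p + 1 + (q + 1) - 1 = p + q + 1 := by omega
  have hcast : (p : ℝ) + 1 + (q + 1) = p + q + 2 := by ring
  have hint : ∀ y : ℝ,
      dirDensity α (Fin.cons y (Fin.cons (x 0 - y) (fun i : Fin m => x i.succ)))
        = (Real.Gamma (p + q + 2 + ∑ i : Fin m, (α i.succ.succ : ℝ)) /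
            (Real.Gamma (p + 1) * Real.Gamma (q + 1) *
              ∏ i : Fin m, Real.Gamma (α i.succ.succ : ℝ)) *
            ∏ i : Fin m, x i.succ ^ (α i.succ.succ - 1)) * (y ^ p * (x 0 - y) ^ q) := by
    intro y
    simp only [dirDensity, Fin.sum_univ_succ (n := m + 1), Fin.prod_univ_succ (n := m + 1),
      Fin.sum_univ_succ (n := m), Fin.prod_univ_succ (n := m), Fin.cons_zero, Fin.cons_succ,
      Fin.succ_zero_eq_one, hp, hq, Nat.cast_add, Nat.cast_one, Nat.add_sub_cancel,
      ← add_assoc, ← hcast]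
    ring
  simp only [hint]
  rw [integral_const_mul, hbeta]
  simp only [dirDensity, Fin.sum_univ_succ (n := m), Fin.prod_univ_succ (n := m), Fin.cons_zero,
    Fin.cons_succ, hp, hq, Nat.cast_add, Nat.cast_one, hexp, hcast]
  field_simp
end
end

section
/- General aggregation property of Dirichlet densities: for every surjective function h : Fin n → Fin m, every α : Fin n → ℕ with α i ≥ 1 for all i, and every measurable subset N ⊆ Δ°_m, ∫_{x ∈ N} d_m(M(h)(α))(x) dx = ∫_{y ∈ D(h)⁻¹(N)} d_n(α)(y) dy, where M(h)(α)(j) = ∑_{i : h i = j} α i and D(h) : Δ°_n → Δ°_m sends y to the point j ↦ ∑_{i : h i = j} y i. -/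
open MeasureTheory Finset

noncomputable section

/-- The density on `ℝ` of the Gamma distribution with shape `a` and rate `1`. -/
def gammaDensity (a : ℕ) (x : ℝ) : ℝ :=
  if 0 < x then x ^ (a - 1) * Real.exp (-x) / Real.Gamma a else 0

lemma gammaDensity_eq_indicator (a : ℕ) :
    gammaDensity a = (Set.Ioi 0).indicator
      fun x => x ^ (a - 1) * Real.exp (-x) / Real.Gamma a := by
  ext x
  simp [gammaDensity, Set.indicator_apply]

lemma gammaDensity_nonneg (a : ℕ) (x : ℝ) : 0 ≤ gammaDensity a x := by
  unfold gammaDensity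
  split_ifs with hx
  · have := Real.Gamma_nonneg_of_nonneg (Nat.cast_nonneg (α := ℝ) a)
    positivity
  · exact le_rfl

lemma measurable_gammaDensity (a : ℕ) : Measurable (gammaDensity a) := by
  rw [gammaDensity_eq_indicator]
  exact Measurable.indicator (by fun_prop) measurableSet_Ioi

lemma integrableOn_pow_mul_exp_neg (k : ℕ) :
    IntegrableOn (fun t : ℝ => t ^ k * Real.exp (-t)) (Set.Ioi 0) := by
  have h := Real.GammaIntegral_convergent (s := k + 1) (by positivity)
  simpa [mul_comm] using h

lemma integrable_gammaDensity (a : ℕ) : Integrable (gammaDensity a) := by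
  rw [gammaDensity_eq_indicator, integrable_indicator_iff measurableSet_Ioi]
  exact (integrableOn_pow_mul_exp_neg _).div_const _

lemma norm_cexp_neg_mul_of_re_eq_one {w : ℂ} (hw : w.re = 1) (t : ℝ) :
    ‖Complex.exp (-w * t)‖ = Real.exp (-t) := by
  simp [Complex.norm_exp, hw]

lemma integrableOn_pow_mul_cexp {w : ℂ} (hw : w.re = 1) (k : ℕ) :
    IntegrableOn (fun t : ℝ => (t : ℂ) ^ k * Complex.exp (-w * t)) (Set.Ioi 0) := by
  refine Integrable.mono' (integrableOn_pow_mul_exp_neg k) (by fun_prop) ?_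
  refine (ae_restrict_mem measurableSet_Ioi).mono fun t ht => ?_
  rw [norm_mul, norm_cexp_neg_mul_of_re_eq_one hw, norm_pow, Complex.norm_real,
    Real.norm_of_nonneg (le_of_lt ht)]

/-- The Laplace transform of `t ^ k` on the line `re w = 1`. -/
lemma integral_pow_mul_cexp {w : ℂ} (hw : w.re = 1) (k : ℕ) :
    ∫ t in Set.Ioi (0 : ℝ), (t : ℂ) ^ k * Complex.exp (-w * t)
      = k.factorial * w⁻¹ ^ (k + 1) := by
  have hw0 : w ≠ 0 := by rintro rfl; simp at hw
  induction k with
  | zero =>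
    have := integral_exp_mul_complex_Ioi (a := -w) (by simp [hw]) 0
    simpa [neg_div_neg_eq] using this
  | succ k ih =>
    have hderiv : ∀ t : ℝ, HasDerivAt
        (fun t : ℝ => -w⁻¹ * ((t : ℂ) ^ (k + 1) * Complex.exp (-w * t)))
        ((t : ℂ) ^ (k + 1) * Complex.exp (-w * t)
          - (k + 1) * w⁻¹ * ((t : ℂ) ^ k * Complex.exp (-w * t))) t := by
      intro t
      have h1 : HasDerivAt (fun z : ℂ => -w⁻¹ * (z ^ (k + 1) * Complex.exp (-w * z)))
          (-w⁻¹ * ((((k + 1 : ℕ) : ℂ) * (t : ℂ) ^ k * 1) * Complex.exp (-w * t)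
            + (t : ℂ) ^ (k + 1) * (Complex.exp (-w * t) * (-w * 1)))) t := by
        exact (((hasDerivAt_id (t : ℂ)).pow (k + 1)).mul
          (((hasDerivAt_id (t : ℂ)).const_mul (-w)).cexp)).const_mul _
      convert h1.comp_ofReal using 1
      push_cast
      field_simp
      ring
    have hlim : Filter.Tendsto
        (fun t : ℝ => -w⁻¹ * ((t : ℂ) ^ (k + 1) * Complex.exp (-w * t)))
        Filter.atTop (nhds 0) := by
      rw [← mul_zero (-w⁻¹)]
      refine Filter.Tendsto.const_mul _ ?_
      rw [tendsto_zero_iff_norm_tendsto_zero]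
      refine (Real.tendsto_pow_mul_exp_neg_atTop_nhds_zero (k + 1)).congr' ?_
      filter_upwards [Filter.eventually_ge_atTop 0] with t ht
      rw [norm_mul, norm_cexp_neg_mul_of_re_eq_one hw, norm_pow, Complex.norm_real,
        Real.norm_of_nonneg ht]
    have hint := (integrableOn_pow_mul_cexp hw k).const_mul ((k + 1) * w⁻¹)
    have h := integral_Ioi_of_hasDerivAt_of_tendsto' (a := 0) (fun t _ => hderiv t)
      ((integrableOn_pow_mul_cexp hw (k + 1)).sub hint) hlim
    rw [integral_sub (integrableOn_pow_mul_cexp hw (k + 1)) hint, integral_const_mul, ih] at h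
    simp only [Complex.ofReal_zero, ne_eq, Nat.succ_ne_zero, not_false_eq_true, zero_pow,
      zero_mul, mul_zero, sub_zero, sub_eq_zero] at h
    rw [h, Nat.factorial_succ]
    push_cast
    ring

/-- The characteristic function of the Gamma distribution. -/
lemma integral_gammaDensity_mul_cexp {a : ℕ} (ha : 1 ≤ a) (θ : ℝ) :
    ∫ x, (gammaDensity a x : ℂ) * Complex.exp (θ * x * Complex.I)
      = (1 - θ * Complex.I)⁻¹ ^ a := by
  obtain ⟨k, rfl⟩ := Nat.exists_eq_add_of_le' ha
  have hw : (1 - θ * Complex.I).re = 1 := by simp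
  have hk : (k.factorial : ℂ) ≠ 0 := by exact_mod_cast k.factorial_ne_zero
  have h : ∀ x, (gammaDensity (k + 1) x : ℂ) * Complex.exp (θ * x * Complex.I)
      = (Set.Ioi (0 : ℝ)).indicator (fun t : ℝ =>
        (k.factorial : ℂ)⁻¹ * ((t : ℂ) ^ k * Complex.exp (-(1 - θ * Complex.I) * t))) x := by
    intro x
    rw [gammaDensity_eq_indicator]
    by_cases hx : x ∈ Set.Ioi (0 : ℝ)
    · rw [Set.indicator_of_mem hx, Set.indicator_of_mem hx,
        show -(1 - θ * Complex.I) * (x : ℂ) = -(x : ℂ) + θ * x * Complex.I by ring, Complex.exp_add]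
      push_cast
      rw [show Real.Gamma ((k : ℝ) + 1) = k.factorial from Real.Gamma_nat_eq_factorial k]
      simp only [Complex.ofReal_natCast]
      ring
    · simp [Set.indicator_of_notMem hx]
  simp_rw [h]
  rw [integral_indicator measurableSet_Ioi, integral_const_mul, integral_pow_mul_cexp hw,
    inv_mul_cancel_left₀ hk]

lemma integral_gammaDensity {a : ℕ} (ha : 1 ≤ a) : ∫ x, gammaDensity a x = 1 := by
  have h := integral_gammaDensity_mul_cexp ha 0
  simp only [Complex.ofReal_zero, zero_mul, Complex.exp_zero, mul_one, sub_zero, inv_one,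
    one_pow] at h
  rw [integral_complex_ofReal] at h
  exact_mod_cast h

/-- The joint distribution of independent Gamma variables with shapes `α i` and rate `1`. -/
def gammaPi {ι : Type*} [Fintype ι] (α : ι → ℕ) : Measure (ι → ℝ) :=
  volume.withDensity fun x => ENNReal.ofReal (∏ i, gammaDensity (α i) (x i))

lemma measurable_prod_gammaDensity {ι : Type*} [Fintype ι] (α : ι → ℕ) :
    Measurable fun x : ι → ℝ => ∏ i, gammaDensity (α i) (x i) :=
  Finset.measurable_prod _ fun i _ => (measurable_gammaDensity _).comp (measurable_pi_apply i)

instance {ι : Type*} [Fintype ι] (α : ι → ℕ) : IsFiniteMeasure (gammaPi α) :=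
  isFiniteMeasure_withDensity_ofReal
    (Integrable.fintype_prod fun i => integrable_gammaDensity (α i)).2

lemma charFunDual_gammaPi {ι : Type*} [Fintype ι] [DecidableEq ι] {α : ι → ℕ}
    (hα : ∀ i, 1 ≤ α i) (L : StrongDual ℝ (ι → ℝ)) :
    charFunDual (gammaPi α) L
      = ∏ i, (1 - (L (Pi.single i 1) : ℝ) * Complex.I)⁻¹ ^ α i := by
  have hL : ∀ x : ι → ℝ, L x = ∑ i, L (Pi.single i 1) * x i := by
    intro x
    conv_lhs => rw [pi_eq_sum_univ' x]
    simp [mul_comm]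
  rw [charFunDual_apply, gammaPi, integral_withDensity_eq_integral_toReal_smul
    (measurable_prod_gammaDensity α).ennreal_ofReal (by simp)]
  simp_rw [← integral_gammaDensity_mul_cexp (hα _)]
  rw [← integral_fintype_prod_volume_eq_prod (fun i (x : ℝ) =>
    (gammaDensity (α i) x : ℂ) * Complex.exp ((L (Pi.single i 1) : ℝ) * x * Complex.I))]
  refine integral_congr_ae (Filter.Eventually.of_forall fun x => ?_)
  simp only
  rw [ENNReal.toReal_ofReal (Finset.prod_nonneg fun i _ => gammaDensity_nonneg _ _), hL,
    Finset.prod_mul_distrib, ← Complex.exp_sum, Complex.real_smul]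
  push_cast
  rw [Finset.sum_mul]

/-- `dPush h` as a continuous linear map. -/
def dPushCLM {n m : ℕ} (h : Fin n → Fin m) : (Fin n → ℝ) →L[ℝ] (Fin m → ℝ) :=
  ContinuousLinearMap.pi fun j => ∑ i with h i = j, ContinuousLinearMap.proj i

lemma coe_dPushCLM {n m : ℕ} (h : Fin n → Fin m) : ⇑(dPushCLM h) = dPush h := by
  ext x j
  simp [dPushCLM, dPush]

lemma measurable_dPush {n m : ℕ} (h : Fin n → Fin m) : Measurable (dPush h) := by
  rw [← coe_dPushCLM]
  exact (dPushCLM h).continuous.measurable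

lemma dPush_single {n m : ℕ} (h : Fin n → Fin m) (i : Fin n) :
    dPush h (Pi.single i 1) = Pi.single (h i) 1 := by
  ext j
  simp [dPush, Pi.single_apply, eq_comm]

lemma dPush_smul {n m : ℕ} (h : Fin n → Fin m) (c : ℝ) (x : Fin n → ℝ) :
    dPush h (c • x) = c • dPush h x := by
  rw [← coe_dPushCLM, map_smul]

lemma sum_dPush {n m : ℕ} (h : Fin n → Fin m) (x : Fin n → ℝ) :
    ∑ j, dPush h x j = ∑ i, x i :=
  Finset.sum_fiberwise _ _ _

lemma one_le_mPush {n m : ℕ} {h : Fin n → Fin m} (hsurj : Function.Surjective h)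
    {α : Fin n → ℕ} (hα : ∀ i, 1 ≤ α i) (j : Fin m) : 1 ≤ mPush h α j := by
  obtain ⟨i, rfl⟩ := hsurj j
  exact (hα i).trans (Finset.single_le_sum (f := α) (fun _ _ => Nat.zero_le _) (by simp))

/-- Sums of independent Gamma variables over the fibres of `h` are independent Gamma variables. -/
lemma map_dPush_gammaPi {n m : ℕ} {h : Fin n → Fin m} (hsurj : Function.Surjective h)
    {α : Fin n → ℕ} (hα : ∀ i, 1 ≤ α i) :
    (gammaPi α).map (dPush h) = gammaPi (mPush h α) := by
  rw [← coe_dPushCLM]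
  refine Measure.ext_of_charFunDual ?_
  ext L
  rw [charFunDual_map, charFunDual_gammaPi hα, charFunDual_gammaPi (one_le_mPush hsurj hα)]
  simp only [ContinuousLinearMap.comp_apply, coe_dPushCLM, dPush_single, mPush,
    ← Finset.prod_pow_eq_pow_sum]
  rw [← Finset.prod_fiberwise _ h]
  refine Finset.prod_congr rfl fun j _ => Finset.prod_congr rfl fun i hi => ?_
  rw [(Finset.mem_filter.1 hi).2]

lemma measurable_toSimplex (n : ℕ) : Measurable (toSimplex n) := by
  refine measurable_pi_iff.2 fun i => ?_
  refine Fin.lastCases ?_ (fun i => ?_) i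
  · simp only [toSimplex, Fin.snoc_last]
    fun_prop
  · simp only [toSimplex, Fin.snoc_castSucc]
    fun_prop

lemma measurableSet_simplexDomain (n : ℕ) : MeasurableSet (simplexDomain n) := by
  unfold simplexDomain
  measurability

lemma sum_toSimplex (n : ℕ) (y : Fin n → ℝ) : ∑ i, toSimplex n y i = 1 := by
  simp [toSimplex, Fin.sum_univ_castSucc]

lemma toSimplex_pos_iff {n : ℕ} {y : Fin n → ℝ} :
    (∀ i, 0 < toSimplex n y i) ↔ y ∈ simplexDomain n := by
  simp [toSimplex, Fin.forall_fin_succ', simplexDomain]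

lemma smul_toSimplex {n : ℕ} (s : ℝ) (y : Fin n → ℝ) :
    s • toSimplex n y = Fin.snoc (s • y) (s - ∑ i, (s • y) i) := by
  ext i
  refine Fin.lastCases ?_ (fun i => ?_) i
  · simp [toSimplex, mul_sub, Finset.mul_sum]
  · simp [toSimplex]

lemma lintegral_smul_eq {n : ℕ} {F : (Fin n → ℝ) → ENNReal} (hF : Measurable F) {s : ℝ}
    (hs : 0 < s) : ∫⁻ y, F y = ENNReal.ofReal (s ^ n) * ∫⁻ y, F (s • y) := by
  have h : ∫⁻ y, F (s • y) = ENNReal.ofReal (s ^ n)⁻¹ * ∫⁻ y, F y := by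
    rw [← lintegral_map (f := F) hF (measurable_const_smul s),
      Measure.map_addHaar_smul _ hs.ne', lintegral_smul_measure]
    simp [abs_of_pos hs]
  rw [h, ← mul_assoc, ← ENNReal.ofReal_mul (by positivity), mul_inv_cancel₀ (by positivity)]
  simp

lemma measurable_snoc (n : ℕ) :
    Measurable fun p : (Fin n → ℝ) × ℝ => (Fin.snoc p.1 p.2 : Fin (n + 1) → ℝ) := by
  refine measurable_pi_iff.2 fun i => ?_
  refine Fin.lastCases ?_ (fun i => ?_) i
  · simp only [Fin.snoc_last]
    fun_prop
  · simp only [Fin.snoc_castSucc]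
    fun_prop

lemma lintegral_eq_lintegral_snoc {n : ℕ} {F : (Fin (n + 1) → ℝ) → ENNReal}
    (hF : Measurable F) :
    ∫⁻ x, F x = ∫⁻ y : Fin n → ℝ, ∫⁻ t : ℝ, F (Fin.snoc y t) := by
  have hmp := (volume_preserving_piFinSuccAbove (fun _ : Fin (n + 1) => ℝ) (Fin.last n)).symm
  have hsnoc : ∀ p : ℝ × (Fin n → ℝ),
      (MeasurableEquiv.piFinSuccAbove (fun _ : Fin (n + 1) => ℝ) (Fin.last n)).symm p
        = Fin.snoc p.2 p.1 := by
    intro p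
    simp [MeasurableEquiv.piFinSuccAbove, Fin.insertNthEquiv, Fin.insertNth_last']
  rw [← hmp.lintegral_comp hF]
  simp_rw [hsnoc]
  exact lintegral_prod_symm' _ (hF.comp ((measurable_snoc n).comp measurable_swap))

/-- Polar decomposition of Lebesgue measure along the rays through the simplex, for functions
vanishing where the coordinate sum is nonpositive. -/
lemma lintegral_eq_lintegral_smul_toSimplex {n : ℕ} {F : (Fin (n + 1) → ℝ) → ENNReal}
    (hF : Measurable F) (hF0 : ∀ x, ∑ i, x i ≤ 0 → F x = 0) :
    ∫⁻ x, F x = ∫⁻ s in Set.Ioi (0 : ℝ),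
      ENNReal.ofReal (s ^ n) * ∫⁻ y, F (s • toSimplex n y) := by
  have hmeas : Measurable fun p : (Fin n → ℝ) × ℝ =>
      F (Fin.snoc p.1 (p.2 - ∑ i, p.1 i) : Fin (n + 1) → ℝ) :=
    hF.comp ((measurable_snoc n).comp (by fun_prop :
      Measurable fun p : (Fin n → ℝ) × ℝ => (p.1, p.2 - ∑ i, p.1 i)))
  calc ∫⁻ x, F x
      = ∫⁻ y : Fin n → ℝ, ∫⁻ s : ℝ, F (Fin.snoc y (s - ∑ i, y i)) := by
        rw [lintegral_eq_lintegral_snoc hF]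
        refine lintegral_congr fun y => ?_
        exact (lintegral_sub_right_eq_self (fun t => F (Fin.snoc y t)) (∑ i, y i)).symm
    _ = ∫⁻ s : ℝ, ∫⁻ y : Fin n → ℝ, F (Fin.snoc y (s - ∑ i, y i)) :=
        lintegral_lintegral_swap hmeas.aemeasurable
    _ = ∫⁻ s in Set.Ioi (0 : ℝ), ∫⁻ y : Fin n → ℝ, F (Fin.snoc y (s - ∑ i, y i)) := by
        refine (setLIntegral_eq_of_support_subset ?_).symm
        intro s hs
        by_contra hs'
        refine hs ?_
        refine lintegral_eq_zero_of_ae_eq_zero ?_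
        refine Filter.Eventually.of_forall fun y => hF0 _ ?_
        simpa [Fin.sum_univ_castSucc] using hs'
    _ = _ := by
        refine setLIntegral_congr_fun measurableSet_Ioi fun s hs => ?_
        simp_rw [smul_toSimplex]
        exact lintegral_smul_eq (hmeas.comp (measurable_id.prodMk measurable_const)) hs

/-- The projection of a vector onto the hyperplane of vectors of sum one, along its ray. -/
def sumNormalize {ι : Type*} [Fintype ι] (x : ι → ℝ) : ι → ℝ := (∑ i, x i)⁻¹ • x

lemma measurable_sumNormalize {ι : Type*} [Fintype ι] :
    Measurable (sumNormalize : (ι → ℝ) → ι → ℝ) := by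
  unfold sumNormalize
  fun_prop

lemma sumNormalize_smul_toSimplex {n : ℕ} {s : ℝ} (hs : s ≠ 0) (y : Fin n → ℝ) :
    sumNormalize (s • toSimplex n y) = toSimplex n y := by
  simp [sumNormalize, ← Finset.mul_sum, sum_toSimplex, smul_smul, hs]

lemma sumNormalize_dPush {n m : ℕ} (h : Fin n → Fin m) (x : Fin n → ℝ) :
    sumNormalize (dPush h x) = dPush h (sumNormalize x) := by
  rw [sumNormalize, sumNormalize, sum_dPush, dPush_smul]

lemma prod_gammaDensity_of_sum_nonpos {ι : Type*} [Fintype ι] [Nonempty ι] (α : ι → ℕ)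
    {x : ι → ℝ} (hx : ∑ i, x i ≤ 0) : ∏ i, gammaDensity (α i) (x i) = 0 := by
  obtain ⟨i, hi⟩ : ∃ i, x i ≤ 0 := by
    by_contra! h
    exact absurd hx (not_le.2 (Finset.sum_pos (fun i _ => h i) Finset.univ_nonempty))
  exact Finset.prod_eq_zero (Finset.mem_univ i) (if_neg (not_lt.2 hi))

lemma prod_gammaDensity_smul_toSimplex {n : ℕ} {α : Fin (n + 1) → ℕ} (hα : ∀ i, 1 ≤ α i)
    {s : ℝ} (hs : 0 < s) (y : Fin n → ℝ) :
    s ^ n * ∏ i, gammaDensity (α i) ((s • toSimplex n y) i)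
      = gammaDensity (∑ i, α i) s
        * (simplexDomain n).indicator (fun y => dirDensity α (toSimplex n y)) y := by
  by_cases hy : y ∈ simplexDomain n
  · have hpos := toSimplex_pos_iff.2 hy
    have hsum : n + ∑ i, (α i - 1) = ∑ i, α i - 1 := by
      have : ∑ i, (α i - 1 + 1) = ∑ i, α i :=
        Finset.sum_congr rfl fun i _ => Nat.sub_add_cancel (hα i)
      simp only [Finset.sum_add_distrib, Finset.sum_const, Finset.card_univ, Fintype.card_fin,
        smul_eq_mul, mul_one] at this
      omega
    have hexp : ∏ i, Real.exp (-(s * toSimplex n y i)) = Real.exp (-s) := by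
      rw [← Real.exp_sum, Finset.sum_neg_distrib, ← Finset.mul_sum, sum_toSimplex, mul_one]
    have hΓ : Real.Gamma (∑ i, (α i : ℝ)) ≠ 0 := by
      refine (Real.Gamma_pos_of_pos (Finset.sum_pos (fun i _ => ?_) Finset.univ_nonempty)).ne'
      exact_mod_cast hα i
    rw [Set.indicator_of_mem hy]
    simp only [gammaDensity, Pi.smul_apply, smul_eq_mul, mul_pos hs (hpos _), hs, if_true,
      Finset.prod_div_distrib, Finset.prod_mul_distrib, mul_pow, Finset.prod_pow_eq_pow_sum,
      hexp, dirDensity, ← hsum, pow_add]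
    push_cast
    field_simp
  · rw [Set.indicator_of_notMem hy, mul_zero]
    obtain ⟨i, hi⟩ : ∃ i, toSimplex n y i ≤ 0 := by
      by_contra! h
      exact hy (toSimplex_pos_iff.1 h)
    rw [Finset.prod_eq_zero (Finset.mem_univ i), mul_zero]
    exact if_neg (not_lt.2 (mul_nonpos_of_nonneg_of_nonpos hs.le hi))

lemma measurable_dirDensity {ι : Type*} [Fintype ι] (α : ι → ℕ) :
    Measurable (dirDensity α : (ι → ℝ) → ℝ) := by
  unfold dirDensity
  fun_prop

lemma lintegral_Ioi_gammaDensity {a : ℕ} (ha : 1 ≤ a) :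
    ∫⁻ s in Set.Ioi (0 : ℝ), ENNReal.ofReal (gammaDensity a s) = 1 := by
  rw [setLIntegral_eq_of_support_subset, ← ofReal_integral_eq_lintegral_ofReal
    (integrable_gammaDensity a) (Filter.Eventually.of_forall (gammaDensity_nonneg a)),
    integral_gammaDensity ha, ENNReal.ofReal_one]
  intro s hs
  by_contra hs'
  exact hs (by simp [gammaDensity, show ¬ 0 < s from hs'])

/-- Normalizing independent Gamma variables gives a Dirichlet distributed vector. -/
lemma map_sumNormalize_gammaPi {n : ℕ} {α : Fin (n + 1) → ℕ} (hα : ∀ i, 1 ≤ α i) :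
    (gammaPi α).map sumNormalize = Dir n α := by
  refine Measure.ext_of_lintegral _ fun f hf => ?_
  have hg := (measurable_prod_gammaDensity α).ennreal_ofReal
  have hd := (measurable_dirDensity α).ennreal_ofReal
  have hfn : Measurable fun x : Fin (n + 1) → ℝ => f (sumNormalize x) :=
    hf.comp measurable_sumNormalize
  have hsum : 1 ≤ ∑ i, α i :=
    (hα 0).trans (Finset.single_le_sum (f := α) (fun _ _ => Nat.zero_le _) (Finset.mem_univ 0))
  rw [lintegral_map hf measurable_sumNormalize, gammaPi,
    lintegral_withDensity_eq_lintegral_mul _ hg hfn, Dir,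
    lintegral_withDensity_eq_lintegral_mul _ hd hf, simplexMeasure,
    lintegral_map (hd.mul hf) (measurable_toSimplex n),
    lintegral_eq_lintegral_smul_toSimplex (hg.mul hfn)
      (fun x hx => by simp [prod_gammaDensity_of_sum_nonpos α hx])]
  set D := ∫⁻ y in simplexDomain n,
    ((fun x => ENNReal.ofReal (dirDensity α x)) * f) (toSimplex n y) with hD
  have key : ∀ s ∈ Set.Ioi (0 : ℝ), ENNReal.ofReal (s ^ n) *
      ∫⁻ y, ((fun x : Fin (n + 1) → ℝ => ENNReal.ofReal (∏ i, gammaDensity (α i) (x i)))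
        * fun x => f (sumNormalize x)) (s • toSimplex n y)
      = ENNReal.ofReal (gammaDensity (∑ i, α i) s) * D := by
    intro s hs
    rw [hD, ← lintegral_indicator (measurableSet_simplexDomain n),
      ← lintegral_const_mul' _ _ ENNReal.ofReal_ne_top,
      ← lintegral_const_mul' _ _ ENNReal.ofReal_ne_top]
    refine lintegral_congr fun y => ?_
    simp only [Pi.mul_apply, sumNormalize_smul_toSimplex (ne_of_gt hs)]
    rw [← mul_assoc, ← ENNReal.ofReal_mul (pow_nonneg (le_of_lt hs) n),
      prod_gammaDensity_smul_toSimplex hα hs, ENNReal.ofReal_mul (gammaDensity_nonneg _ _),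
      mul_assoc]
    congr 1
    by_cases hy : y ∈ simplexDomain n <;> simp [hy]
  rw [setLIntegral_congr_fun measurableSet_Ioi key,
    lintegral_mul_const _ (measurable_gammaDensity _).ennreal_ofReal,
    lintegral_Ioi_gammaDensity hsum, one_mul]

lemma map_dPush_Dir {n m : ℕ} {h : Fin (n + 1) → Fin (m + 1)} (hsurj : Function.Surjective h)
    {α : Fin (n + 1) → ℕ} (hα : ∀ i, 1 ≤ α i) :
    (Dir n α).map (dPush h) = Dir m (mPush h α) := by
  rw [← map_sumNormalize_gammaPi hα, ← map_sumNormalize_gammaPi (one_le_mPush hsurj hα),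
    ← map_dPush_gammaPi hsurj hα, Measure.map_map (measurable_dPush h) measurable_sumNormalize,
    Measure.map_map measurable_sumNormalize (measurable_dPush h)]
  congr 1
  ext1 x
  exact (sumNormalize_dPush h x).symm

lemma setIntegral_dirDensity {n : ℕ} (α : Fin (n + 1) → ℕ) {S : Set (Fin (n + 1) → ℝ)}
    (hS : MeasurableSet S) :
    ∫ x in S, dirDensity α x ∂simplexMeasure n = (Dir n α S).toReal := by
  have hpos : ∀ᵐ x ∂simplexMeasure n, 0 ≤ dirDensity α x := by
    rw [simplexMeasure, ae_map_iff (measurable_toSimplex n).aemeasurable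
      (measurableSet_le measurable_const (measurable_dirDensity α))]
    refine (ae_restrict_mem (measurableSet_simplexDomain n)).mono fun y hy => ?_
    have hy' := toSimplex_pos_iff.2 hy
    refine mul_nonneg (div_nonneg (Real.Gamma_nonneg_of_nonneg (by positivity))
      (Finset.prod_nonneg fun i _ => Real.Gamma_nonneg_of_nonneg (by positivity)))
      (Finset.prod_nonneg fun i _ => pow_nonneg (hy' i).le _)
  rw [integral_eq_lintegral_of_nonneg_ae (ae_restrict_of_ae hpos)
    (measurable_dirDensity α).aestronglyMeasurable, Dir, withDensity_apply _ hS]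

/-- **General aggregation property of Dirichlet densities.** For every surjective
function `h : Fin n → Fin m` (with `n, m ≥ 1`), every `α : Fin n → ℕ` with
`α i ≥ 1` for all `i`, and every measurable subset `N ⊆ Δ°_m`,
`∫_{x ∈ N} d_m(M(h)(α))(x) dx = ∫_{y ∈ D(h)⁻¹(N)} d_n(α)(y) dy`, where
`M(h)(α)(j) = ∑_{i : h i = j} α i` and `D(h)(y)(j) = ∑_{i : h i = j} y i`. -/
theorem dirichlet_aggregation_general (n m : ℕ) (h : Fin (n + 1) → Fin (m + 1))
    (hsurj : Function.Surjective h) (α : Fin (n + 1) → ℕ) (hα : ∀ i, 1 ≤ α i)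
    (N : Set (Fin (m + 1) → ℝ)) (hN : MeasurableSet N)
    (hNs : N ⊆ openSimplex (m + 1)) :
    ∫ x in N, dirDensity (mPush h α) x ∂simplexMeasure m
      = ∫ y in dPush h ⁻¹' N, dirDensity α y ∂simplexMeasure n := by
  rw [setIntegral_dirDensity _ hN, setIntegral_dirDensity _ (measurable_dPush h hN),
    ← map_dPush_Dir hsurj hα, Measure.map_apply (measurable_dPush h) hN]
end
end

section
/- Validity under frequentist and Bayesian learning agree: for every α : Fin n → ℕ with α i ≥ 1 for all i and every predicate p : Fin n → [0,1], the validity of p in the maximal likelihood estimate equals the validity of the lifted predicate p̂(x) = ∑ i, p i · x i in the Dirichlet distribution; explicitly, ∑ i, p i · (α i / ∑ j, α j) = ∫_{x ∈ Δ°_n} (∑ i, p i · x i) · d_n(α)(x) dx. -/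
open MeasureTheory Finset

noncomputable section

open scoped Nat

/-- The Beta integral with natural exponents, scaled to the interval from `0` to `s`. -/
theorem integral_pow_mul_sub_pow_s13 (s : ℝ) (a b : ℕ) :
    ∫ t in (0 : ℝ)..s, t ^ a * (s - t) ^ b
      = s ^ (a + b + 1) * ((a ! : ℝ) * b ! / (a + b + 1)!) := by
  induction b generalizing a with
  | zero =>
    simp only [pow_zero, mul_one, integral_pow, add_zero, Nat.factorial_zero, Nat.cast_one,
      Nat.factorial_succ]
    have := Nat.factorial_ne_zero a
    push_cast
    field_simp
    simp
  | succ b ih =>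
    have hderiv : ∀ t ∈ Set.uIcc 0 s, HasDerivAt (fun t : ℝ => t ^ (a + 1) * (s - t) ^ (b + 1))
        ((a + 1) * (t ^ a * (s - t) ^ (b + 1)) - (b + 1) * (t ^ (a + 1) * (s - t) ^ b)) t := by
      intro t _
      have h := (hasDerivAt_pow (a + 1) t).mul (((hasDerivAt_id t).const_sub s).pow (b + 1))
      refine h.congr_deriv ?_
      simp
      ring
    have hint := intervalIntegral.integral_eq_sub_of_hasDerivAt hderiv
      (Continuous.intervalIntegrable (by fun_prop) _ _)
    rw [intervalIntegral.integral_sub (Continuous.intervalIntegrable (by fun_prop) _ _)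
      (Continuous.intervalIntegrable (by fun_prop) _ _), intervalIntegral.integral_const_mul,
      intervalIntegral.integral_const_mul, ih] at hint
    have hexp : a + 1 + b + 1 = a + (b + 1) + 1 := by ring
    rw [hexp] at hint
    have ha : ((a : ℝ) + 1) ≠ 0 := by positivity
    apply mul_left_cancel₀ ha
    rw [Nat.factorial_succ a] at hint
    rw [Nat.factorial_succ b]
    simp only [sub_self, ne_eq, Nat.add_eq_zero_iff, one_ne_zero, and_false, not_false_eq_true,
      zero_pow, mul_zero, zero_mul] at hint
    push_cast at hint ⊢
    linear_combination hint

/-- The open corner simplex of side `s`: positive coordinates with sum less than `s`. -/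
def scaledSimplexDomain (m : ℕ) (s : ℝ) : Set (Fin m → ℝ) :=
  {y | (∀ i, 0 < y i) ∧ ∑ i, y i < s}

theorem measurableSet_scaledSimplexDomain (m : ℕ) (s : ℝ) :
    MeasurableSet (scaledSimplexDomain m s) := by
  have hset : scaledSimplexDomain m s
      = (⋂ i, {y : Fin m → ℝ | 0 < y i}) ∩ {y | ∑ i, y i < s} := by
    ext y
    simp [scaledSimplexDomain]
  rw [hset]
  exact (MeasurableSet.iInter fun i =>
    measurableSet_lt measurable_const (measurable_pi_apply i)).inter
      (measurableSet_lt (by fun_prop) measurable_const)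

theorem scaledSimplexDomain_subset_Icc (m : ℕ) (s : ℝ) :
    scaledSimplexDomain m s ⊆ Set.Icc 0 (fun _ => s) := fun _ hy =>
  ⟨fun i => (hy.1 i).le, fun i =>
    (Finset.single_le_sum (fun j _ => (hy.1 j).le) (Finset.mem_univ i)).trans hy.2.le⟩

theorem Continuous.integrableOn_scaledSimplexDomain {m : ℕ} {f : (Fin m → ℝ) → ℝ}
    (hf : Continuous f) (s : ℝ) : IntegrableOn f (scaledSimplexDomain m s) :=
  hf.integrableOn_Icc.mono_set (scaledSimplexDomain_subset_Icc m s)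

theorem cons_mem_scaledSimplexDomain {m : ℕ} {s t : ℝ} {z : Fin m → ℝ} :
    (Fin.cons t z : Fin (m + 1) → ℝ) ∈ scaledSimplexDomain (m + 1) s
      ↔ 0 < t ∧ z ∈ scaledSimplexDomain m (s - t) := by
  simp only [scaledSimplexDomain, Set.mem_ofPred_eq, Fin.forall_fin_succ, Fin.cons_zero,
    Fin.cons_succ, Fin.sum_univ_succ, and_assoc, lt_sub_iff_add_lt']

theorem scaledSimplexDomain_eq_empty {m : ℕ} {s : ℝ} (hs : s ≤ 0) :
    scaledSimplexDomain m s = ∅ := by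
  ext y
  simp only [scaledSimplexDomain, Set.mem_ofPred_eq, Set.mem_empty_iff_false, iff_false, not_and,
    not_lt]
  exact fun h => hs.trans (Finset.sum_nonneg fun i _ => (h i).le)

/-- Fubini for the corner simplex, slicing along the first coordinate. -/
theorem integral_scaledSimplexDomain_succ {m : ℕ} {f : (Fin (m + 1) → ℝ) → ℝ}
    (hf : Continuous f) {s : ℝ} (hs : 0 ≤ s) :
    ∫ y in scaledSimplexDomain (m + 1) s, f y
      = ∫ t in (0 : ℝ)..s, ∫ z in scaledSimplexDomain m (s - t), f (Fin.cons t z) := by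
  have hmeas := measurableSet_scaledSimplexDomain (m + 1) s
  have hmp := (volume_preserving_piFinSuccAbove (fun _ : Fin (m + 1) => ℝ) 0).symm
  have hInt : Integrable ((scaledSimplexDomain (m + 1) s).indicator f) :=
    (hf.integrableOn_scaledSimplexDomain s).integrable_indicator hmeas
  have hInt' := (hmp.integrable_comp_emb (MeasurableEquiv.measurableEmbedding _)).2 hInt
  rw [← integral_indicator hmeas, ← hmp.integral_comp (MeasurableEquiv.measurableEmbedding _)]
  have hcons : ∀ q : ℝ × (Fin m → ℝ),
      (MeasurableEquiv.piFinSuccAbove (fun _ : Fin (m + 1) => ℝ) 0).symm q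
        = (Fin.cons q.1 q.2 : Fin (m + 1) → ℝ) := fun q => by
    simp [MeasurableEquiv.piFinSuccAbove, Fin.insertNthEquiv]
  refine (integral_prod _ hInt').trans ?_
  rw [intervalIntegral.integral_of_le hs, ← integral_indicator measurableSet_Ioc]
  refine integral_congr_ae (Filter.Eventually.of_forall fun t => ?_)
  simp only [hcons, Function.comp_apply]
  by_cases ht : t ∈ Set.Ioc 0 s
  · rw [Set.indicator_of_mem ht, ← integral_indicator (measurableSet_scaledSimplexDomain m _)]
    refine integral_congr_ae (Filter.Eventually.of_forall fun z => ?_)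
    have hiff := cons_mem_scaledSimplexDomain (s := s) (t := t) (z := z)
    by_cases hz : z ∈ scaledSimplexDomain m (s - t)
    · exact (Set.indicator_of_mem (hiff.2 ⟨ht.1, hz⟩) f).trans
        (Set.indicator_of_mem hz fun z : Fin m → ℝ => f (Fin.cons t z)).symm
    · exact (Set.indicator_of_notMem (fun hmem => hz (hiff.1 hmem).2) f).trans
        (Set.indicator_of_notMem hz _).symm
  · rw [Set.indicator_of_notMem ht]
    refine integral_eq_zero_of_ae (Filter.Eventually.of_forall fun z => ?_)
    refine Set.indicator_of_notMem (fun hmem => ht ?_) _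
    obtain ⟨h0, hz⟩ := cons_mem_scaledSimplexDomain.1 hmem
    refine ⟨h0, le_of_not_gt fun hlt => ?_⟩
    rw [scaledSimplexDomain_eq_empty (by linarith)] at hz
    exact hz

/-- The Dirichlet integral with natural exponents over the corner simplex of side `s`. -/
theorem integral_scaledSimplexDomain_prod_pow {m : ℕ} (k : Fin m → ℕ) (l : ℕ) {s : ℝ}
    (hs : 0 < s) :
    ∫ y in scaledSimplexDomain m s, (∏ i, y i ^ k i) * (s - ∑ i, y i) ^ l
      = s ^ (∑ i, k i + l + m) * ((∏ i, ((k i)! : ℝ)) * l ! / (∑ i, k i + l + m)!) := by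
  induction m generalizing s with
  | zero =>
    have huniv : scaledSimplexDomain 0 s = Set.univ := by
      ext y
      simp [scaledSimplexDomain, hs]
    have hl : (l ! : ℝ) ≠ 0 := by positivity
    simp [huniv, hl, integral_unique, Measure.real, volume_pi]
  | succ m ih =>
    rw [integral_scaledSimplexDomain_succ (by fun_prop) hs.le]
    have hslice : ∀ t ∈ Set.Ioo 0 s,
        ∫ z in scaledSimplexDomain m (s - t),
            (∏ i, (Fin.cons t z : Fin (m + 1) → ℝ) i ^ k i)
              * (s - ∑ i, (Fin.cons t z : Fin (m + 1) → ℝ) i) ^ l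
          = t ^ k 0 * (s - t) ^ (∑ i : Fin m, k i.succ + l + m)
            * ((∏ i : Fin m, ((k i.succ)! : ℝ)) * l ! / (∑ i : Fin m, k i.succ + l + m)!) := by
      intro t ht
      simp only [Fin.prod_univ_succ, Fin.sum_univ_succ, Fin.cons_zero, Fin.cons_succ, mul_assoc,
        ← sub_sub, integral_const_mul]
      rw [ih _ (sub_pos.2 ht.2)]
    rw [intervalIntegral.integral_of_le hs.le, integral_Ioc_eq_integral_Ioo,
      setIntegral_congr_fun measurableSet_Ioo hslice, ← integral_Ioc_eq_integral_Ioo,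
      ← intervalIntegral.integral_of_le hs.le, intervalIntegral.integral_mul_const,
      integral_pow_mul_sub_pow_s13]
    have hexp : k 0 + (∑ i : Fin m, k i.succ + l + m) + 1 = ∑ i, k i + l + (m + 1) := by
      rw [Fin.sum_univ_succ]
      ring
    rw [hexp, Fin.prod_univ_succ]
    have hN : ((∑ i : Fin m, k i.succ + l + m)! : ℝ) ≠ 0 := by positivity
    field_simp

theorem continuous_toSimplex (m : ℕ) : Continuous (toSimplex m) := by
  refine continuous_pi fun i => ?_
  refine Fin.lastCases ?_ (fun j => ?_) i
  · simp only [toSimplex, Fin.snoc_last]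
    fun_prop
  · simp only [toSimplex, Fin.snoc_castSucc]
    fun_prop

theorem simplexDomain_eq_scaledSimplexDomain (m : ℕ) :
    simplexDomain m = scaledSimplexDomain m 1 := rfl

theorem Continuous.integrable_simplexMeasure {m : ℕ} {f : (Fin (m + 1) → ℝ) → ℝ}
    (hf : Continuous f) : Integrable f (simplexMeasure m) :=
  (integrable_map_measure hf.aestronglyMeasurable (continuous_toSimplex m).aemeasurable).2
    ((hf.comp (continuous_toSimplex m)).integrableOn_scaledSimplexDomain 1)

/-- The Dirichlet integral with natural exponents over the open simplex. -/
theorem integral_simplexMeasure_prod_pow {m : ℕ} (k : Fin (m + 1) → ℕ) :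
    ∫ x, ∏ i, x i ^ k i ∂simplexMeasure m = (∏ i, ((k i)! : ℝ)) / (∑ i, k i + m)! := by
  have hcont : Continuous fun x : Fin (m + 1) → ℝ => ∏ i, x i ^ k i := by fun_prop
  rw [simplexMeasure, integral_map (continuous_toSimplex m).aemeasurable
    hcont.aestronglyMeasurable, simplexDomain_eq_scaledSimplexDomain]
  simp only [Fin.prod_univ_castSucc, Fin.sum_univ_castSucc, toSimplex, Fin.snoc_castSucc,
    Fin.snoc_last]
  rw [integral_scaledSimplexDomain_prod_pow _ _ one_pos, one_pow, one_mul]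

/-- The mean of the `i`-th coordinate under the Dirichlet density. -/
theorem integral_apply_mul_dirDensity {m : ℕ} (α : Fin (m + 1) → ℕ) (hα : ∀ i, 1 ≤ α i)
    (i : Fin (m + 1)) :
    ∫ x, x i * dirDensity α x ∂simplexMeasure m = (α i : ℝ) / ∑ j, (α j : ℝ) := by
  obtain ⟨a, rfl⟩ : ∃ a : Fin (m + 1) → ℕ, α = fun j => a j + 1 :=
    ⟨fun j => α j - 1, funext fun j => (Nat.sub_add_cancel (hα j)).symm⟩
  have hmono : ∀ x : Fin (m + 1) → ℝ,
      x i * ∏ j, x j ^ a j = ∏ j, x j ^ (a j + if j = i then 1 else 0) := fun x => by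
    simp only [pow_add, Finset.prod_mul_distrib, pow_ite, pow_one, pow_zero,
      Finset.prod_ite_eq', Finset.mem_univ, if_true]
    ring
  have hfact : ∏ j, ((a j + if j = i then 1 else 0)! : ℝ) = (a i + 1) * ∏ j, ((a j)! : ℝ) := by
    have h : ∀ j, ((a j + if j = i then 1 else 0)! : ℝ)
        = (if j = i then (a j + 1 : ℝ) else 1) * (a j)! := fun j => by
      split_ifs
      · rw [Nat.factorial_succ]
        push_cast
        ring
      · simp
    simp only [h, Finset.prod_mul_distrib, Finset.prod_ite_eq', Finset.mem_univ, if_true]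
  have hsum : ∑ j, (((a j + 1 : ℕ)) : ℝ) = ((∑ j, a j + m : ℕ) : ℝ) + 1 := by
    push_cast
    simp [Finset.sum_add_distrib]
    ring
  have hexp : ∑ j, (a j + if j = i then 1 else 0) + m = ∑ j, a j + m + 1 := by
    simp [Finset.sum_add_distrib]
    ring
  simp only [dirDensity, Nat.add_sub_cancel, mul_left_comm (_ : ℝ) (_ / _ : ℝ), hmono,
    integral_const_mul]
  rw [integral_simplexMeasure_prod_pow, hfact, hexp, hsum, Real.Gamma_nat_eq_factorial,
    Nat.factorial_succ]
  simp only [Nat.cast_add, Nat.cast_one, Real.Gamma_nat_eq_factorial, Nat.cast_mul]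
  have h1 : ∏ j, ((a j)! : ℝ) ≠ 0 := Finset.prod_ne_zero_iff.2 fun j _ => by positivity
  have h2 : ((∑ j, a j + m)! : ℝ) ≠ 0 := by positivity
  field_simp

/-- **Validity under frequentist and Bayesian learning agree.** For every
`α : Fin n → ℕ` (with `n = m + 1 ≥ 1`) such that `α i ≥ 1` for all `i`, and every
predicate `p : Fin n → [0,1]`, the validity of `p` in the maximal likelihood
estimate equals the validity of the lifted predicate `p̂(x) = ∑ i, p i · x i`
in the Dirichlet distribution:
`∑ i, p i · (α i / ∑ j, α j) = ∫_{Δ°_n} (∑ i, p i · x i) · d(α)(x) dx`. -/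
theorem mle_dirichlet_validity (m : ℕ) (α : Fin (m + 1) → ℕ) (hα : ∀ i, 1 ≤ α i)
    (p : Fin (m + 1) → ℝ) (hp : ∀ i, p i ∈ Set.Icc (0 : ℝ) 1) :
    ∑ i, p i * ((α i : ℝ) / ∑ j, (α j : ℝ))
      = ∫ x, (∑ i, p i * x i) * dirDensity α x ∂simplexMeasure m := by
  have hcont : ∀ i, Continuous fun x : Fin (m + 1) → ℝ => x i * dirDensity α x := fun i => by
    unfold dirDensity
    fun_prop
  simp only [Finset.sum_mul, mul_assoc]
  rw [integral_finsetSum _ fun i _ => ((hcont i).integrable_simplexMeasure).const_mul (p i)]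
  simp only [integral_const_mul, integral_apply_mul_dirDensity α hα]
end
end
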